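/- Let r_0 ≥ 2 and r_1 ≥ 0 be integers, r = r_0 + r_1, p ≥ 2, and ε > 0. There exists a constant C = C(r_0, r_1, p, ε) > 0 such that for every real N ≥ 1 and every family of complex coefficients (a_ξ) indexed by ξ = (ξ_0, ξ_1) ∈ ℤ_{≥0}^{r_0} × ℤ^{r_1} with |ξ| ≤ N, one has ( ∫_{[0,2π]^{1+r_1}} | ∑_{ξ ∈ ℤ_{≥0}^{r_0} × ℤ^{r_1}, |ξ| ≤ N} a_ξ e^{−i t |ξ|² + i⟨x_1, ξ_1⟩} |^p dt dx_1 )^{1/p} ≤ C · N^{r/2 − (2 + r_1)/p + ε} · (∑_{ξ} |a_ξ|²)^{1/2}. -/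

import Mathlib

open MeasureTheory Real
open scoped Classical

noncomputable section

/-- The squared Euclidean norm `|ξ|²` of a lattice point. -/
def eNormSq {r : ℕ} (ξ : Fin r → ℤ) : ℝ := ∑ i, ((ξ i : ℝ)) ^ 2

/-- The set of frequencies `ξ ∈ ℤ_{≥0}^{r₀} × ℤ^{r₁}` with `|ξ| ≤ N` (a finite set,
realized as a filter of the envelope box `[-⌊N⌋, ⌊N⌋]^{r₀+r₁}`). -/
def quarterBall (r₀ r₁ : ℕ) (N : ℝ) : Finset (Fin (r₀ + r₁) → ℤ) :=
  (Fintype.piFinset fun _ : Fin (r₀ + r₁) => Finset.Icc (-⌊N⌋) ⌊N⌋).filter fun ξ =>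
    (∀ i : Fin (r₀ + r₁), (i : ℕ) < r₀ → 0 ≤ ξ i) ∧ eNormSq ξ ≤ N ^ 2

namespace GaussianInt

/-- If `ϖ` divides the rational prime `p`, every Gaussian integer of norm `p ^ k * m` with `p ∤ m`
is a product of powers of `ϖ` and its conjugate with an element of norm `m`. -/
theorem exists_eq_pow_mul_star_pow_mul {p : ℕ} (hp : p.Prime) {ϖ : GaussianInt} (hϖ : Prime ϖ)
    (hϖp : ϖ ∣ (p : GaussianInt)) {m : ℕ} (hm : ¬ p ∣ m) (k : ℕ) :
    ∀ z : GaussianInt, z.norm = (p ^ k * m : ℕ) →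
      ∃ i ≤ k, ∃ j ≤ k, ∃ w : GaussianInt, w.norm = m ∧ z = ϖ ^ i * star ϖ ^ j * w := by
  have hnorm : ∃ e, 1 ≤ e ∧ ϖ.norm = (p ^ e : ℕ) := by
    obtain ⟨c, hc⟩ := hϖp
    have h1 : ϖ.norm.natAbs ∣ p ^ 2 := by
      refine ⟨c.norm.natAbs, ?_⟩
      have := congrArg Zsqrtd.norm hc
      rw [Zsqrtd.norm_mul, Zsqrtd.norm_natCast] at this
      rw [← Int.natAbs_mul, ← this, Int.natAbs_mul, Int.natAbs_natCast, sq]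
    obtain ⟨e, -, he⟩ := (Nat.dvd_prime_pow hp).1 h1
    refine ⟨e, ?_, ?_⟩
    · by_contra h
      have he0 : e = 0 := by lia
      rw [he0, pow_zero] at he
      exact hϖ.not_isUnit (Zsqrtd.norm_eq_one_iff.1 he)
    · rw [← he, Int.natAbs_of_nonneg (norm_nonneg ϖ)]
  obtain ⟨e, he1, he⟩ := hnorm
  induction k using Nat.strong_induction_on with
  | _ k ih =>
  intro z hz
  rcases Nat.eq_zero_or_pos k with rfl | hk
  · exact ⟨0, le_rfl, 0, le_rfl, z, by simpa using hz, by simp⟩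
  have step : ∀ ρ w : GaussianInt, ρ.norm = (p ^ e : ℕ) → z = ρ * w →
      ∃ k' < k, w.norm = (p ^ k' * m : ℕ) := by
    intro ρ w hρ hw
    have h := congrArg Zsqrtd.norm hw
    rw [Zsqrtd.norm_mul, hz, hρ] at h
    have hw' : w.norm = (w.norm.natAbs : ℤ) := (Int.natAbs_of_nonneg (norm_nonneg w)).symm
    rw [hw'] at h
    have h' : p ^ k * m = p ^ e * w.norm.natAbs := by exact_mod_cast h
    have hek : e ≤ k := by
      by_contra hlt
      push Not at hlt
      have h2 : p ^ k * p ∣ p ^ k * m := by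
        rw [h', ← pow_succ]
        exact (pow_dvd_pow p hlt).mul_right _
      exact hm (Nat.dvd_of_mul_dvd_mul_left (pow_pos hp.pos k) h2)
    refine ⟨k - e, by lia, ?_⟩
    rw [hw']
    have h3 : p ^ e * (p ^ (k - e) * m) = p ^ e * w.norm.natAbs := by
      rw [← h', ← mul_assoc, ← pow_add, Nat.add_sub_cancel' hek]
    exact_mod_cast (Nat.eq_of_mul_eq_mul_left (pow_pos hp.pos e) h3).symm
  have hdvd : ϖ ∣ z * star z := by
    rw [← Zsqrtd.norm_eq_mul_conj, hz]
    refine hϖp.trans ?_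
    have : p ∣ p ^ k * m := (dvd_pow_self p (by lia)).mul_right m
    rw [Int.cast_natCast]
    exact Nat.cast_dvd_cast this
  rcases hϖ.dvd_or_dvd hdvd with ⟨w, hw⟩ | ⟨w, hw⟩
  · obtain ⟨k', hk', hn⟩ := step ϖ w he hw
    obtain ⟨i, hi, j, hj, v, hv, rfl⟩ := ih k' hk' w hn
    exact ⟨i + 1, by lia, j, by lia, v, hv, by rw [hw]; ring⟩
  · have hw' : z = star ϖ * star w := by
      rw [← star_star z, hw, star_mul, mul_comm]
    obtain ⟨k', hk', hn⟩ := step (star ϖ) (star w) (by rw [Zsqrtd.norm_conj, he]) hw'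
    obtain ⟨i, hi, j, hj, v, hv, hwv⟩ := ih k' hk' _ hn
    exact ⟨i, by lia, j + 1, by lia, v, hv, by rw [hw', hwv]; ring⟩

theorem card_le_mul_card_divisors_sq (m : ℕ) (hm : m ≠ 0) :
    ∀ S : Finset GaussianInt, (∀ z ∈ S, z.norm = m) → S.card ≤ 9 * m.divisors.card ^ 2 := by
  induction m using Nat.strong_induction_on with
  | _ m ih =>
  intro S hS
  rcases eq_or_ne m 1 with rfl | hm1
  · have hsub : S ⊆ (Finset.Icc (-1 : ℤ) 1 ×ˢ Finset.Icc (-1 : ℤ) 1).image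
        (fun q => (⟨q.1, q.2⟩ : GaussianInt)) := by
      intro z hz
      have h := hS z hz
      rw [Zsqrtd.norm_def] at h
      simp only [Finset.mem_image, Finset.mem_product, Finset.mem_Icc]
      refine ⟨(z.re, z.im), ⟨⟨?_, ?_⟩, ?_, ?_⟩, rfl⟩ <;> push_cast at h <;>
        nlinarith [sq_nonneg z.re, sq_nonneg z.im]
    refine (Finset.card_le_card hsub).trans (Finset.card_image_le.trans ?_)
    simp
  obtain ⟨p, hp, hpm⟩ := Nat.exists_prime_and_dvd hm1
  obtain ⟨k, n, hn, rfl⟩ := Nat.exists_eq_pow_mul_and_not_dvd hm p hp.ne_one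
  have hn0 : n ≠ 0 := by rintro rfl; simp at hm
  have hk : k ≠ 0 := by rintro rfl; simp at hpm; exact hn hpm
  have hlt : n < p ^ k * n :=
    lt_mul_of_one_lt_left (Nat.pos_of_ne_zero hn0) (Nat.one_lt_pow hk hp.one_lt)
  have hpu : ¬ IsUnit (p : GaussianInt) := by
    intro h
    have h := Zsqrtd.norm_eq_one_iff.2 h
    rw [Zsqrtd.norm_natCast, Int.natAbs_mul, Int.natAbs_natCast] at h
    exact hp.ne_one (Nat.eq_one_of_mul_eq_one_right h)
  obtain ⟨ϖ, hϖ, hϖp⟩ := WfDvdMonoid.exists_irreducible_factor hpu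
    (Nat.cast_ne_zero.2 hp.ne_zero)
  have hdec := exists_eq_pow_mul_star_pow_mul hp hϖ.prime hϖp hn k
  choose! i hi j hj w hw hz using hdec
  have hsub : S ⊆ (Finset.range (k + 1) ×ˢ Finset.range (k + 1) ×ˢ S.image w).image
      (fun q => ϖ ^ q.1 * star ϖ ^ q.2.1 * q.2.2) := by
    intro z hzS
    simp only [Finset.mem_image, Finset.mem_product, Finset.mem_range]
    exact ⟨(i z, j z, w z), ⟨Nat.lt_succ_of_le (hi z (hS z hzS)),
      Nat.lt_succ_of_le (hj z (hS z hzS)), z, hzS, rfl⟩, (hz z (hS z hzS)).symm⟩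
  have hW := ih n hlt hn0 (S.image w) (by
    intro v hv
    obtain ⟨z, hzS, rfl⟩ := Finset.mem_image.1 hv
    exact hw z (hS z hzS))
  have hcop : (p ^ k).Coprime n := ((Nat.Prime.coprime_iff_not_dvd hp).2 hn).pow_left k
  have hdk : (p ^ k).divisors.card = k + 1 := by
    rw [Nat.divisors_prime_pow hp, Finset.card_map, Finset.card_range]
  refine (Finset.card_le_card hsub).trans (Finset.card_image_le.trans ?_)
  rw [Finset.card_product, Finset.card_product, Finset.card_range, hcop.card_divisors_mul, hdk]
  calc (k + 1) * ((k + 1) * (S.image w).card)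
      ≤ (k + 1) * ((k + 1) * (9 * n.divisors.card ^ 2)) := by gcongr
    _ = 9 * ((k + 1) * n.divisors.card) ^ 2 := by ring

end GaussianInt

/-- The divisor bound `d(n) = O(n ^ δ)`. -/
theorem Nat.exists_card_divisors_le_mul_rpow (δ : ℝ) (hδ : 0 < δ) :
    ∃ C : ℝ, 0 < C ∧ ∀ n : ℕ, n ≠ 0 → (n.divisors.card : ℝ) ≤ C * (n : ℝ) ^ δ := by
  set h : ℝ := 2 ^ δ - 1 with hh
  have hpos : 0 < h := by
    have := Real.one_lt_rpow (x := 2) (by norm_num) hδ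
    linarith
  set K : ℝ := max 1 (1 / h) with hK
  have hK1 : 1 ≤ K := le_max_left _ _
  set X : ℕ := ⌈(2 : ℝ) ^ (1 / δ)⌉₊ with hX
  refine ⟨K ^ X, by positivity, fun n hn => ?_⟩
  have hfac : ∀ p ∈ n.primeFactors, ((n.factorization p : ℝ) + 1) ≤
      (if p < X then K else 1) * ((p : ℝ) ^ n.factorization p) ^ δ := by
    intro p hp
    have hp2 : (2 : ℝ) ≤ p := by exact_mod_cast (Nat.prime_of_mem_primeFactors hp).two_le
    set k := n.factorization p
    have hswap : ((p : ℝ) ^ k) ^ δ = ((p : ℝ) ^ δ) ^ k := by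
      rw [← Real.rpow_natCast, ← Real.rpow_natCast, ← Real.rpow_mul (by positivity),
        ← Real.rpow_mul (by positivity), mul_comm]
    rw [hswap]
    split_ifs with hlt
    · have h1 : 1 + (k : ℝ) * h ≤ ((p : ℝ) ^ δ) ^ k := by
        refine (one_add_mul_le_pow (by linarith) k).trans ?_
        refine pow_le_pow_left₀ (by linarith) ?_ k
        have : (2 : ℝ) ^ δ ≤ (p : ℝ) ^ δ := Real.rpow_le_rpow (by norm_num) hp2 hδ.le
        linarith
      have h2 : 1 ≤ K * h := by
        have := le_max_right 1 (1 / h)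
        rwa [div_le_iff₀ hpos] at this
      calc (k : ℝ) + 1 ≤ K * (1 + k * h) := by
            have : (k : ℝ) * 1 ≤ k * (K * h) := by gcongr
            linarith
        _ ≤ _ := by gcongr
    · have h1 : (2 : ℝ) ≤ (p : ℝ) ^ δ := by
        have h3 : (2 : ℝ) ^ (1 / δ) ≤ p := by
          refine (Nat.le_ceil _).trans ?_
          exact_mod_cast not_lt.1 hlt
        have := Real.rpow_le_rpow (by positivity) h3 hδ.le
        rwa [← Real.rpow_mul (by norm_num), one_div_mul_cancel hδ.ne', Real.rpow_one] at this
      have h2 : (1 : ℝ) + k * 1 ≤ (1 + 1) ^ k := one_add_mul_le_pow (by norm_num) k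
      have h3 : ((1 : ℝ) + 1) ^ k ≤ ((p : ℝ) ^ δ) ^ k := by
        gcongr
        linarith
      linarith
  have hprod : ∏ p ∈ n.primeFactors, (if p < X then K else 1) ≤ K ^ X := by
    rw [Finset.prod_ite, Finset.prod_const, Finset.prod_const_one, mul_one]
    refine pow_le_pow_right₀ hK1 ?_
    calc _ ≤ (Finset.range X).card := Finset.card_le_card (by
          intro p hp
          simpa using (Finset.mem_filter.1 hp).2)
      _ = X := Finset.card_range X
  have hself : ∏ p ∈ n.primeFactors, ((p : ℝ) ^ n.factorization p) ^ δ = (n : ℝ) ^ δ := by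
    rw [Real.finsetProd_rpow _ _ (fun _ _ => by positivity)]
    congr 1
    exact_mod_cast Nat.prod_factorization_pow_eq_self hn
  rw [Nat.card_divisors hn]
  push_cast
  calc _ ≤ ∏ p ∈ n.primeFactors,
        ((if p < X then K else 1) * ((p : ℝ) ^ n.factorization p) ^ δ) :=
        Finset.prod_le_prod (fun _ _ => by positivity) hfac
    _ ≤ _ := by
        rw [Finset.prod_mul_distrib, hself]
        gcongr

/-- The number of integer points on the circle `x² + y² = m` is `O(M ^ δ)` for `m ≤ M`. -/
theorem exists_card_sum_two_sq_le (δ : ℝ) (hδ : 0 < δ) :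
    ∃ C : ℝ, 0 < C ∧ ∀ (M : ℝ) (m : ℤ), 1 ≤ M → (m : ℝ) ≤ M → ∀ S : Finset (ℤ × ℤ),
      (∀ q ∈ S, q.1 ^ 2 + q.2 ^ 2 = m) → (S.card : ℝ) ≤ C * M ^ δ := by
  obtain ⟨C, hC, hdiv⟩ := Nat.exists_card_divisors_le_mul_rpow (δ / 2) (by positivity)
  refine ⟨9 * C ^ 2 + 1, by positivity, fun M m hM hmM S hS => ?_⟩
  have hMδ : 1 ≤ M ^ δ := Real.one_le_rpow hM hδ.le
  rcases S.eq_empty_or_nonempty with rfl | ⟨q₀, hq₀⟩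
  · simp only [Finset.card_empty, Nat.cast_zero]
    positivity
  have hm0 : 0 ≤ m := by rw [← hS q₀ hq₀]; positivity
  lift m to ℕ using hm0
  rcases eq_or_ne m 0 with rfl | hm
  · have hsub : S ⊆ {(0, 0)} := by
      intro q hq
      have h := hS q hq
      have h1 : q.1 = 0 := by push_cast at h; nlinarith [sq_nonneg q.1, sq_nonneg q.2]
      have h2 : q.2 = 0 := by push_cast at h; nlinarith [sq_nonneg q.1, sq_nonneg q.2]
      simp [Prod.ext_iff, h1, h2]
    have h1 : (S.card : ℝ) ≤ 1 := by exact_mod_cast Finset.card_le_card hsub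
    nlinarith [sq_nonneg C]
  have hinj : Function.Injective (fun q : ℤ × ℤ => (⟨q.1, q.2⟩ : GaussianInt)) := by
    intro a b hab
    simpa [Zsqrtd.ext_iff, Prod.ext_iff] using hab
  have hcard := GaussianInt.card_le_mul_card_divisors_sq m hm
    (S.image fun q : ℤ × ℤ => (⟨q.1, q.2⟩ : GaussianInt)) (by
      intro z hz
      obtain ⟨q, hq, rfl⟩ := Finset.mem_image.1 hz
      rw [Zsqrtd.norm_def, ← hS q hq]
      ring)
  rw [Finset.card_image_of_injective _ hinj] at hcard
  have hm' : (m : ℝ) ≤ M := by exact_mod_cast hmM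
  calc (S.card : ℝ) ≤ 9 * (m.divisors.card : ℝ) ^ 2 := by exact_mod_cast hcard
    _ ≤ 9 * (C * (m : ℝ) ^ (δ / 2)) ^ 2 := by gcongr; exact hdiv m hm
    _ = 9 * C ^ 2 * (m : ℝ) ^ δ := by
        rw [mul_pow, ← Real.rpow_natCast ((m : ℝ) ^ (δ / 2)), ← Real.rpow_mul (by positivity)]
        norm_num
        ring
    _ ≤ 9 * C ^ 2 * M ^ δ := by gcongr
    _ ≤ _ := by nlinarith

/-- The space-time plane wave `e^{-itl + i⟨x, w⟩}`. -/
def planeWave {n : ℕ} (l : ℤ) (w : Fin n → ℤ) (t : ℝ) (x : Fin n → ℝ) : ℂ :=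
  Complex.exp (Complex.I * ((-(t * l) + ∑ i, x i * (w i : ℝ) : ℝ) : ℂ))

theorem norm_planeWave {n : ℕ} (l : ℤ) (w : Fin n → ℤ) (t : ℝ) (x : Fin n → ℝ) :
    ‖planeWave l w t x‖ = 1 := by
  rw [planeWave, mul_comm, Complex.norm_exp_ofReal_mul_I]

theorem continuous_planeWave {n : ℕ} (l : ℤ) (w : Fin n → ℤ) :
    Continuous (Function.uncurry (planeWave l w)) := by
  unfold planeWave Function.uncurry
  fun_prop

theorem planeWave_mul_conj {n : ℕ} (l l' : ℤ) (w w' : Fin n → ℤ) (t : ℝ) (x : Fin n → ℝ) :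
    planeWave l w t x * (starRingEnd ℂ) (planeWave l' w' t x) =
      planeWave (l - l') (w - w') t x := by
  unfold planeWave
  rw [← Complex.exp_conj, ← Complex.exp_add]
  congr 1
  rw [map_mul, Complex.conj_I, Complex.conj_ofReal, neg_mul, ← sub_eq_add_neg, ← mul_sub,
    ← Complex.ofReal_sub]
  congr 2
  simp only [Pi.sub_apply, Int.cast_sub, mul_sub, Finset.sum_sub_distrib]
  ring

theorem integral_exp_int_mul (m : ℤ) :
    ∫ x in (0 : ℝ)..(2 * π), Complex.exp (Complex.I * m * x) =
      if m = 0 then (2 * π : ℂ) else 0 := by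
  split_ifs with h
  · simp [h]
  · rw [integral_exp_mul_complex (mul_ne_zero Complex.I_ne_zero (Int.cast_ne_zero.2 h))]
    have : Complex.exp (Complex.I * m * ((2 * π : ℝ) : ℂ)) = 1 := by
      rw [Complex.exp_eq_one_iff]
      exact ⟨m, by push_cast; ring⟩
    rw [this]
    simp

theorem isCompact_box (n : ℕ) :
    IsCompact (Set.univ.pi fun _ : Fin n => Set.Icc (0 : ℝ) (2 * π)) :=
  isCompact_univ_pi fun _ => isCompact_Icc

theorem integral_planeWave {n : ℕ} (l : ℤ) (w : Fin n → ℤ) :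
    ∫ t in (0 : ℝ)..(2 * π), ∫ x in (Set.univ.pi fun _ : Fin n => Set.Icc (0 : ℝ) (2 * π)),
      planeWave l w t x = if l = 0 ∧ w = 0 then (2 * π : ℂ) ^ (n + 1) else 0 := by
  have hsplit : ∀ (t : ℝ) (x : Fin n → ℝ), planeWave l w t x =
      Complex.exp (Complex.I * ((-l : ℤ) : ℂ) * t) *
        ∏ i, Complex.exp (Complex.I * (w i : ℂ) * (x i : ℂ)) := by
    intro t x
    rw [← Complex.exp_sum, ← Complex.exp_add, planeWave]
    congr 1
    push_cast
    rw [mul_add, Finset.mul_sum]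
    congr 1
    · ring
    · exact Finset.sum_congr rfl fun i _ => by ring
  have hcoord : ∀ i, ∫ y in Set.Icc (0 : ℝ) (2 * π), Complex.exp (Complex.I * (w i : ℂ) * (y : ℂ)) =
      if w i = 0 then (2 * π : ℂ) else 0 := by
    intro i
    rw [integral_Icc_eq_integral_Ioc, ← intervalIntegral.integral_of_le (by positivity),
      integral_exp_int_mul]
  have hspace : ∫ x in (Set.univ.pi fun _ : Fin n => Set.Icc (0 : ℝ) (2 * π)),
      ∏ i, Complex.exp (Complex.I * (w i : ℂ) * (x i : ℂ)) =
        if w = 0 then (2 * π : ℂ) ^ n else 0 := by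
    rw [volume_pi, Measure.restrict_pi_pi,
      integral_fintype_prod_eq_prod
        (f := fun (i : Fin n) (y : ℝ) => Complex.exp (Complex.I * (w i : ℂ) * (y : ℂ)))]
    simp only [hcoord]
    split_ifs with h
    · simp [h]
    · obtain ⟨i, hi⟩ := Function.ne_iff.1 h
      exact Finset.prod_eq_zero (Finset.mem_univ i) (if_neg hi)
  simp only [hsplit, integral_const_mul, hspace, intervalIntegral.integral_mul_const,
    integral_exp_int_mul, neg_eq_zero]
  split_ifs <;> simp_all [pow_succ']

theorem intervalIntegral_setIntegral_finsetSum {ι : Type*} {n : ℕ} (s : Finset ι)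
    (f : ι → ℝ → (Fin n → ℝ) → ℂ) (hf : ∀ j ∈ s, Continuous (Function.uncurry (f j)))
    {S : Set (Fin n → ℝ)} (hS : IsCompact S) (a b : ℝ) :
    ∫ t in a..b, ∫ x in S, ∑ j ∈ s, f j t x = ∑ j ∈ s, ∫ t in a..b, ∫ x in S, f j t x := by
  rw [← intervalIntegral.integral_finsetSum]
  · refine intervalIntegral.integral_congr fun t _ => integral_finsetSum _ fun j hj => ?_
    exact ((hf j hj).comp (Continuous.prodMk_right t)).continuousOn.integrableOn_compact hS
  · intro j hj
    exact (continuous_parametric_integral_of_continuous (hf j hj) hS).intervalIntegrable _ _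

theorem integral_norm_sq_sum_planeWave_le {ι : Type*} {n : ℕ} (s : Finset ι) (a : ι → ℂ)
    (l : ι → ℤ) (w : ι → Fin n → ℤ) (R : ℝ)
    (hR : ∀ j ∈ s, ((s.filter fun k => l j = l k ∧ w j = w k).card : ℝ) ≤ R) :
    ∫ t in (0 : ℝ)..(2 * π), ∫ x in (Set.univ.pi fun _ : Fin n => Set.Icc (0 : ℝ) (2 * π)),
      ‖∑ j ∈ s, a j * planeWave (l j) (w j) t x‖ ^ 2 ≤
        (2 * π) ^ (n + 1) * R * ∑ j ∈ s, ‖a j‖ ^ 2 := by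
  set B := Set.univ.pi fun _ : Fin n => Set.Icc (0 : ℝ) (2 * π)
  have hexpand : ∀ (t : ℝ) (x : Fin n → ℝ),
      ((‖∑ j ∈ s, a j * planeWave (l j) (w j) t x‖ ^ 2 : ℝ) : ℂ) =
        ∑ q ∈ s ×ˢ s, a q.1 * (starRingEnd ℂ) (a q.2) *
          planeWave (l q.1 - l q.2) (w q.1 - w q.2) t x := by
    intro t x
    rw [← Complex.normSq_eq_norm_sq, ← Complex.mul_conj, map_sum, Finset.sum_mul_sum,
      Finset.sum_product]
    refine Finset.sum_congr rfl fun j _ => Finset.sum_congr rfl fun k _ => ?_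
    rw [← planeWave_mul_conj, map_mul]
    ring
  have hI : ((∫ t in (0 : ℝ)..(2 * π), ∫ x in B,
      ‖∑ j ∈ s, a j * planeWave (l j) (w j) t x‖ ^ 2 : ℝ) : ℂ) =
        ∑ q ∈ s ×ˢ s, a q.1 * (starRingEnd ℂ) (a q.2) *
          if l q.1 = l q.2 ∧ w q.1 = w q.2 then (2 * π : ℂ) ^ (n + 1) else 0 := by
    rw [← intervalIntegral.integral_ofReal]
    simp only [← integral_complex_ofReal, hexpand]
    rw [intervalIntegral_setIntegral_finsetSum _ _ _ (isCompact_box n)]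
    · refine Finset.sum_congr rfl fun q _ => ?_
      simp only [integral_const_mul, intervalIntegral.integral_const_mul]
      rw [integral_planeWave]
      simp only [sub_eq_zero]
    · intro q _
      exact continuous_const.mul (continuous_planeWave _ _)
  have hbound : ∀ q ∈ s ×ˢ s, ‖a q.1 * (starRingEnd ℂ) (a q.2) *
      if l q.1 = l q.2 ∧ w q.1 = w q.2 then (2 * π : ℂ) ^ (n + 1) else 0‖ ≤
        (2 * π) ^ (n + 1) * ((if l q.1 = l q.2 ∧ w q.1 = w q.2 then ‖a q.1‖ ^ 2 else 0) / 2 +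
          (if l q.2 = l q.1 ∧ w q.2 = w q.1 then ‖a q.2‖ ^ 2 else 0) / 2) := by
    intro q _
    by_cases h : l q.1 = l q.2 ∧ w q.1 = w q.2
    · rw [if_pos h, if_pos h, if_pos ⟨h.1.symm, h.2.symm⟩, norm_mul, norm_mul, RCLike.norm_conj,
        norm_pow, norm_mul, Complex.norm_ofNat, Complex.norm_real, Real.norm_of_nonneg pi_pos.le,
        mul_comm]
      gcongr
      nlinarith [sq_nonneg (‖a q.1‖ - ‖a q.2‖)]
    · rw [if_neg h, mul_zero, norm_zero]
      positivity
  have hschur : ∑ j ∈ s, ∑ k ∈ s, (if l j = l k ∧ w j = w k then ‖a j‖ ^ 2 else 0) ≤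
      R * ∑ j ∈ s, ‖a j‖ ^ 2 := by
    rw [Finset.mul_sum]
    refine Finset.sum_le_sum fun j hj => ?_
    rw [← Finset.sum_filter, Finset.sum_const, nsmul_eq_mul]
    gcongr
    exact hR j hj
  have hle := (Complex.re_le_norm _).trans ((congrArg norm hI).le.trans
    ((norm_sum_le _ _).trans (Finset.sum_le_sum hbound)))
  rw [Complex.ofReal_re] at hle
  refine hle.trans ?_
  rw [← Finset.mul_sum, Finset.sum_add_distrib, ← Finset.sum_div, ← Finset.sum_div,
    Finset.sum_product, Finset.sum_product_right, mul_assoc]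
  gcongr
  linarith

/-- The integer-valued squared norm of a lattice point. -/
def intNormSq {r : ℕ} (ξ : Fin r → ℤ) : ℤ := ∑ i, ξ i ^ 2

theorem eNormSq_eq_intCast {r : ℕ} (ξ : Fin r → ℤ) : eNormSq ξ = (intNormSq ξ : ℝ) := by
  simp [eNormSq, intNormSq]

theorem mem_Icc_of_mem_quarterBall {r₀ r₁ : ℕ} {N : ℝ} {ξ : Fin (r₀ + r₁) → ℤ}
    (h : ξ ∈ quarterBall r₀ r₁ N) (i : Fin (r₀ + r₁)) : ξ i ∈ Finset.Icc (-⌊N⌋) ⌊N⌋ :=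
  Fintype.mem_piFinset.1 (Finset.mem_filter.1 h).1 i

theorem intNormSq_le_of_mem_quarterBall {r₀ r₁ : ℕ} {N : ℝ} {ξ : Fin (r₀ + r₁) → ℤ}
    (h : ξ ∈ quarterBall r₀ r₁ N) : (intNormSq ξ : ℝ) ≤ N ^ 2 := by
  rw [← eNormSq_eq_intCast]
  exact (Finset.mem_filter.1 h).2.2

theorem card_piFinset_Icc_floor_le (k : ℕ) {N : ℝ} (hN : 1 ≤ N) :
    ((Fintype.piFinset fun _ : Fin k => Finset.Icc (-⌊N⌋) ⌊N⌋).card : ℝ) ≤ (3 * N) ^ k := by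
  rw [Fintype.card_piFinset_const, Int.card_Icc, Nat.cast_pow]
  refine pow_le_pow_left₀ (by positivity) ?_ k
  have h0 : 0 ≤ ⌊N⌋ := Int.floor_nonneg.2 (by linarith)
  have h1 : (((⌊N⌋ + 1 - -⌊N⌋).toNat : ℤ) : ℝ) = ((⌊N⌋ + 1 - -⌊N⌋ : ℤ) : ℝ) := by
    rw [Int.toNat_of_nonneg (by lia)]
  have h2 : (⌊N⌋ : ℝ) ≤ N := Int.floor_le N
  rw [Int.cast_natCast] at h1
  rw [h1]
  push_cast
  linarith

theorem card_quarterBall_le (r₀ r₁ : ℕ) {N : ℝ} (hN : 1 ≤ N) :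
    ((quarterBall r₀ r₁ N).card : ℝ) ≤ (3 * N) ^ (r₀ + r₁) :=
  (Nat.cast_le.2 (Finset.card_filter_le _ _)).trans (card_piFinset_Icc_floor_le _ hN)

theorem intNormSq_eq_add {k r₁ : ℕ} (η : Fin (k + 2 + r₁) → ℤ) :
    intNormSq η = η (Fin.castAdd r₁ 0) ^ 2 + η (Fin.castAdd r₁ 1) ^ 2 +
      ∑ j : Fin k, η (Fin.castAdd r₁ j.succ.succ) ^ 2 +
      ∑ i : Fin r₁, η (Fin.natAdd (k + 2) i) ^ 2 := by
  rw [intNormSq, Fin.sum_univ_add, Fin.sum_univ_succ, Fin.sum_univ_succ, Fin.succ_zero_eq_one]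
  ring

/-- The number of frequencies in the ball with prescribed norm and prescribed last `r₁`
coordinates. -/
theorem exists_card_resonant_le (k r₁ : ℕ) (δ : ℝ) (hδ : 0 < δ) :
    ∃ C : ℝ, 0 < C ∧ ∀ N : ℝ, 1 ≤ N → ∀ ξ ∈ quarterBall (k + 2) r₁ N,
      (((quarterBall (k + 2) r₁ N).filter fun η => intNormSq ξ = intNormSq η ∧
        (fun i : Fin r₁ => ξ (Fin.natAdd (k + 2) i)) = fun i => η (Fin.natAdd (k + 2) i)).card : ℝ)
          ≤ C * (N ^ 2) ^ δ * (3 * N) ^ k := by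
  obtain ⟨C, hC, hcirc⟩ := exists_card_sum_two_sq_le δ hδ
  refine ⟨C, hC, fun N hN ξ hξ => ?_⟩
  set T := (quarterBall (k + 2) r₁ N).filter fun η => intNormSq ξ = intNormSq η ∧
    (fun i : Fin r₁ => ξ (Fin.natAdd (k + 2) i)) = fun i => η (Fin.natAdd (k + 2) i) with hT
  set f : (Fin (k + 2 + r₁) → ℤ) → Fin k → ℤ := fun η j => η (Fin.castAdd r₁ j.succ.succ) with hf
  have hfiber : ∀ b ∈ T.image f, (T.filter fun η => f η = b).card ≤ ⌊C * (N ^ 2) ^ δ⌋₊ := by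
    intro b _
    refine Nat.le_floor ?_
    set m : ℤ := intNormSq ξ - ∑ j, b j ^ 2 - ∑ i : Fin r₁, ξ (Fin.natAdd (k + 2) i) ^ 2 with hm
    have hmN : (m : ℝ) ≤ N ^ 2 := by
      refine le_trans ?_ (intNormSq_le_of_mem_quarterBall hξ)
      rw [Int.cast_le, hm]
      have h1 : 0 ≤ ∑ j, b j ^ 2 := Finset.sum_nonneg fun _ _ => sq_nonneg _
      have h2 : 0 ≤ ∑ i : Fin r₁, ξ (Fin.natAdd (k + 2) i) ^ 2 :=
        Finset.sum_nonneg fun _ _ => sq_nonneg _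
      linarith
    set g : (Fin (k + 2 + r₁) → ℤ) → ℤ × ℤ :=
      fun η => (η (Fin.castAdd r₁ 0), η (Fin.castAdd r₁ 1)) with hg
    have hinj : Set.InjOn g (T.filter fun η => f η = b) := by
      intro η hη η' hη' heq
      simp only [hT, Finset.coe_filter, Finset.mem_filter, Set.mem_ofPred_eq] at hη hη'
      simp only [hg, Prod.mk.injEq] at heq
      funext i
      refine Fin.addCases (fun i => ?_) (fun i => ?_) i
      · refine Fin.cases heq.1 (fun i => ?_) i
        refine Fin.cases heq.2 (fun j => ?_) i
        exact congrFun (hη.2.trans hη'.2.symm) j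
      · exact congrFun (hη.1.2.2.symm.trans hη'.1.2.2) i
    rw [← Finset.card_image_of_injOn hinj]
    refine hcirc (N ^ 2) m (one_le_pow₀ hN) hmN _ ?_
    intro q hq
    obtain ⟨η, hη, rfl⟩ := Finset.mem_image.1 hq
    obtain ⟨hηT, rfl⟩ := Finset.mem_filter.1 hη
    obtain ⟨-, hη1, hη2⟩ := Finset.mem_filter.1 hηT
    have h3 : ∀ i, ξ (Fin.natAdd (k + 2) i) = η (Fin.natAdd (k + 2) i) := congrFun hη2
    simp only [hm, hg, hf, h3]
    rw [hη1, intNormSq_eq_add]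
    ring
  have himage : ((T.image f).card : ℝ) ≤ (3 * N) ^ k := by
    refine le_trans (Nat.cast_le.2 (Finset.card_le_card ?_)) (card_piFinset_Icc_floor_le k hN)
    intro b hb
    obtain ⟨η, hη, rfl⟩ := Finset.mem_image.1 hb
    exact Fintype.mem_piFinset.2 fun j =>
      mem_Icc_of_mem_quarterBall (Finset.mem_filter.1 hη).1 _
  calc (T.card : ℝ) ≤ (⌊C * (N ^ 2) ^ δ⌋₊ : ℝ) * (T.image f).card := by
        exact_mod_cast Finset.card_le_mul_card_image T _ hfiber
    _ ≤ _ := by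
        gcongr
        exact Nat.floor_le (by positivity)

theorem norm_sum_mul_planeWave_le {ι : Type*} {n : ℕ} (s : Finset ι) (a : ι → ℂ)
    (l : ι → ℤ) (w : ι → Fin n → ℤ) (t : ℝ) (x : Fin n → ℝ) :
    ‖∑ j ∈ s, a j * planeWave (l j) (w j) t x‖ ≤
      ((s.card : ℝ) * ∑ j ∈ s, ‖a j‖ ^ 2) ^ ((1 : ℝ) / 2) := by
  rw [← Real.sqrt_eq_rpow]
  refine (norm_sum_le _ _).trans (Real.le_sqrt_of_sq_le ?_)
  simp only [norm_mul, norm_planeWave, mul_one]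
  exact sq_sum_le_card_mul_sum_sq

/-- Interpolation of an `L^p` norm between an `L^2` and an `L^∞` bound. -/
theorem integral_norm_rpow_le {n : ℕ} {F : ℝ → (Fin n → ℝ) → ℂ}
    (hF : Continuous (Function.uncurry F)) {S : Set (Fin n → ℝ)} (hS : IsCompact S)
    {a b : ℝ} (hab : a ≤ b) {p : ℝ} (hp : 2 ≤ p) {M : ℝ} (hM : ∀ t x, ‖F t x‖ ≤ M) :
    ∫ t in a..b, ∫ x in S, ‖F t x‖ ^ p ≤
      M ^ (p - 2) * ∫ t in a..b, ∫ x in S, ‖F t x‖ ^ 2 := by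
  have hc1 : Continuous (Function.uncurry fun t x => ‖F t x‖ ^ p) :=
    hF.norm.rpow_const fun _ => Or.inr (by linarith)
  have hc2 : Continuous (Function.uncurry fun t x => M ^ (p - 2) * ‖F t x‖ ^ 2) :=
    continuous_const.mul (hF.norm.pow 2)
  have hpt : ∀ t x, ‖F t x‖ ^ p ≤ M ^ (p - 2) * ‖F t x‖ ^ 2 := by
    intro t x
    calc ‖F t x‖ ^ p = ‖F t x‖ ^ ((p - 2) + (2 : ℝ)) := by rw [sub_add_cancel]
      _ = ‖F t x‖ ^ (p - 2) * ‖F t x‖ ^ 2 := by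
        rw [Real.rpow_add_of_nonneg (norm_nonneg _) (by linarith) (by norm_num), Real.rpow_two]
      _ ≤ _ := by
        gcongr
        exact hM t x
  rw [← intervalIntegral.integral_const_mul]
  simp only [← integral_const_mul]
  refine intervalIntegral.integral_mono_on hab
    ((continuous_parametric_integral_of_continuous hc1 hS).intervalIntegrable _ _)
    ((continuous_parametric_integral_of_continuous hc2 hS).intervalIntegrable _ _) fun t _ => ?_
  exact setIntegral_mono_on
    ((hc1.comp (Continuous.prodMk_right t)).continuousOn.integrableOn_compact hS)
    ((hc2.comp (Continuous.prodMk_right t)).continuousOn.integrableOn_compact hS)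
    hS.measurableSet fun x _ => hpt t x

theorem anisotropic_strichartz_eps_loss
    (r₀ r₁ : ℕ) (hr₀ : 2 ≤ r₀) (p : ℝ) (hp : 2 ≤ p) (ε : ℝ) (hε : 0 < ε) :
    ∃ C : ℝ, 0 < C ∧ ∀ (N : ℝ), 1 ≤ N →
      ∀ a : (Fin (r₀ + r₁) → ℤ) → ℂ,
        (∫ t in (0:ℝ)..(2 * π),
          ∫ x₁ in (Set.univ.pi fun _ : Fin r₁ => Set.Icc (0:ℝ) (2 * π)),
            ‖∑ ξ ∈ quarterBall r₀ r₁ N,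
                a ξ * Complex.exp (Complex.I *
                  (((-(t * eNormSq ξ) +
                      ∑ i : Fin r₁, x₁ i * (ξ (Fin.natAdd r₀ i) : ℝ)) : ℝ) : ℂ))‖ ^ p) ^ (1 / p)
          ≤ C * N ^ ((r₀ + r₁ : ℝ) / 2 - (2 + (r₁ : ℝ)) / p + ε) *
            (∑ ξ ∈ quarterBall r₀ r₁ N, ‖a ξ‖ ^ 2) ^ ((1 : ℝ) / 2) := by
  obtain ⟨k, rfl⟩ := Nat.exists_eq_add_of_le' hr₀
  have hp0 : 0 < p := by linarith
  obtain ⟨C, hC, hres⟩ := exists_card_resonant_le k r₁ (p * ε / 2) (by positivity)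
  set r := k + 2 + r₁ with hr
  set D : ℝ := ((3 : ℝ) ^ r) ^ ((p - 2) / 2) * ((2 * π) ^ (r₁ + 1) * (C * 3 ^ k)) with hD
  refine ⟨D ^ (1 / p), by positivity, fun N hN a => ?_⟩
  have hN0 : 0 < N := by linarith
  set s := quarterBall (k + 2) r₁ N
  set A : ℝ := ∑ ξ ∈ s, ‖a ξ‖ ^ 2
  have hA : 0 ≤ A := by positivity
  set F : ℝ → (Fin r₁ → ℝ) → ℂ := fun t x => ∑ ξ ∈ s, a ξ *
    planeWave (intNormSq ξ) (fun i : Fin r₁ => ξ (Fin.natAdd (k + 2) i)) t x with hFdef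
  have hF : Continuous (Function.uncurry F) :=
    continuous_finsetSum _ fun ξ _ => continuous_const.mul (continuous_planeWave _ _)
  have hsup : ∀ t x, ‖F t x‖ ≤ ((3 * N) ^ r * A) ^ ((1 : ℝ) / 2) := by
    intro t x
    refine (norm_sum_mul_planeWave_le _ _ _ _ _ _).trans ?_
    gcongr
    exact card_quarterBall_le (k + 2) r₁ hN
  have hL2 := integral_norm_sq_sum_planeWave_le s a intNormSq
    (fun ξ (i : Fin r₁) => ξ (Fin.natAdd (k + 2) i)) _ (hres N hN)
  have hLp := integral_norm_rpow_le hF (isCompact_box r₁) (a := 0) (b := 2 * π)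
    (by positivity) hp hsup
  have hbound := hLp.trans (mul_le_mul_of_nonneg_left hL2 (by positivity))
  have hexp : (r : ℝ) * ((p - 2) / 2) + p * ε + k =
      p * (((k + 2 : ℕ) + r₁ : ℝ) / 2 - (2 + (r₁ : ℝ)) / p + ε) := by
    rw [hr]
    push_cast
    field_simp
    ring
  have hvalue : (((3 * N) ^ r * A) ^ ((1 : ℝ) / 2)) ^ (p - 2) *
      ((2 * π) ^ (r₁ + 1) * (C * (N ^ 2) ^ (p * ε / 2) * (3 * N) ^ k) * A) =
        D * (N ^ (((k + 2 : ℕ) + r₁ : ℝ) / 2 - (2 + (r₁ : ℝ)) / p + ε)) ^ p *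
          (A ^ ((1 : ℝ) / 2)) ^ p := by
    have h1 : (((3 * N) ^ r * A) ^ ((1 : ℝ) / 2)) ^ (p - 2) =
        ((3 : ℝ) ^ r) ^ ((p - 2) / 2) * N ^ ((r : ℝ) * ((p - 2) / 2)) * A ^ ((p - 2) / 2) := by
      rw [← Real.rpow_mul (by positivity), Real.mul_rpow (by positivity) hA, mul_pow,
        Real.mul_rpow (by positivity) (by positivity), Real.rpow_mul hN0.le, Real.rpow_natCast]
      ring_nf
    have h2 : (N ^ 2) ^ (p * ε / 2) = N ^ (p * ε) := by
      rw [← Real.rpow_two, ← Real.rpow_mul hN0.le]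
      ring_nf
    have h3 : (A ^ ((1 : ℝ) / 2)) ^ p = A ^ ((p - 2) / 2) * A := by
      conv_rhs => rw [← Real.rpow_one A, ← Real.rpow_mul hA, one_mul]
      rw [← Real.rpow_mul hA, ← Real.rpow_add_of_nonneg hA (by linarith) zero_le_one]
      ring_nf
    rw [h1, h2, h3, ← Real.rpow_mul hN0.le, mul_comm _ p, ← hexp, Real.rpow_add hN0,
      Real.rpow_add hN0, Real.rpow_natCast, hD]
    ring
  rw [hvalue] at hbound
  have hroot : ∀ y : ℝ, 0 ≤ y → (y ^ p) ^ (1 / p) = y := fun y hy => by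
    rw [one_div, Real.rpow_rpow_inv hy hp0.ne']
  have hpos : 0 ≤ ∫ t in (0 : ℝ)..(2 * π),
      ∫ x in (Set.univ.pi fun _ : Fin r₁ => Set.Icc (0 : ℝ) (2 * π)), ‖F t x‖ ^ p :=
    intervalIntegral.integral_nonneg (by positivity) fun t _ =>
      integral_nonneg fun x => by positivity
  have hfinal := Real.rpow_le_rpow hpos hbound (z := 1 / p) (by positivity)
  rw [Real.mul_rpow (by positivity) (by positivity), Real.mul_rpow (by positivity) (by positivity),
    hroot _ (by positivity), hroot _ (by positivity)] at hfinal
  simpa only [hFdef, planeWave, eNormSq_eq_intCast] using hfinal
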